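/- Let P be a finite-dimensional real vector space, let Λ ⊂ P be a closed strictly convex polyhedral cone with nonempty interior, and let Λ^∨ = {y ∈ P^∨ : y(x) ≥ 0 for all x ∈ Λ} be its dual cone, equipped with a Lebesgue measure dy on P^∨. Then for every x in the interior of Λ the integral 𝒳_Λ(x) = ∫_{Λ^∨} e^{−y(x)} dy converges, i.e., is finite. -/

import Mathlib

/-!
Statement 10.  `P` is a finite-dimensional real vector space, realized as
`ℝ^p`; its dual `P^∨` is identified with `ℝ^p` via the standard pairing
`y(x) = ∑ k, y k * x k`, and a Lebesgue measure on `P^∨` is an (arbitrary)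
additive Haar measure `μ` on `ℝ^p`.  `Λ ⊆ P` is a closed strictly convex
polyhedral cone (the set of nonnegative combinations of finitely many
vectors, containing no nonzero linear subspace) with nonempty interior, and
`Λ^∨ = {y | y(x) ≥ 0 ∀ x ∈ Λ}` is its dual cone.  Conclusion: for `x` in the
interior of `Λ`, `𝒳_Λ(x) = ∫_{Λ^∨} e^{-y(x)} dy` is finite, i.e. the
integrand is integrable on `Λ^∨`.
-/

open MeasureTheory
open scoped BigOperators

theorem aux_exp_abs {c : ℝ} (hc : 0 < c) : Integrable (fun t : ℝ => Real.exp (-(c * |t|))) := by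
  rw [← integrableOn_univ, ← Set.Iic_union_Ioi (a := (0:ℝ)), integrableOn_union]
  constructor
  · refine (integrableOn_exp_mul_Iic hc 0).congr_fun (fun t ht => ?_) measurableSet_Iic
    have : t ≤ 0 := ht
    simp [abs_of_nonpos this]
  · refine (integrableOn_exp_mul_Ioi (neg_lt_zero.2 hc) 0).congr_fun (fun t ht => ?_) measurableSet_Ioi
    have : 0 < t := ht
    simp [abs_of_pos this]

theorem statement10 (p : ℕ) (Λ : Set (Fin p → ℝ))
    -- `Λ` is a polyhedral cone ...
    (hpoly : ∃ (N : ℕ) (gen : Fin N → (Fin p → ℝ)),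
      Λ = {x | ∃ t : Fin N → ℝ, (∀ i, 0 ≤ t i) ∧ x = ∑ i, t i • gen i})
    -- ... which is closed ...
    (hclosed : IsClosed Λ)
    -- ... strictly convex ...
    (hstrict : ∀ x ∈ Λ, -x ∈ Λ → x = 0)
    -- ... and has nonempty interior
    (hint : (interior Λ).Nonempty)
    -- a Lebesgue measure on `P^∨`
    (μ : Measure (Fin p → ℝ)) [μ.IsAddHaarMeasure]
    (x : Fin p → ℝ) (hx : x ∈ interior Λ) :
    IntegrableOn (fun y : Fin p → ℝ => Real.exp (-∑ k, y k * x k))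
      {y : Fin p → ℝ | ∀ z ∈ Λ, 0 ≤ ∑ k, y k * z k} μ := by
  obtain ⟨ε, hε, hball⟩ := Metric.mem_nhds_iff.1 (mem_interior_iff_mem_nhds.1 hx)
  have hc : 0 < ε / 2 / (p + 1) := by positivity
  have hI : Integrable (fun y : Fin p → ℝ => ∏ k, Real.exp (-(ε / 2 / (p + 1) * |y k|))) volume :=
    Integrable.fintype_prod (f := fun _ t => Real.exp (-(ε / 2 / (p + 1) * |t|)))
      (fun _ => aux_exp_abs hc)
  have hIμ : Integrable (fun y : Fin p → ℝ => ∏ k, Real.exp (-(ε / 2 / (p + 1) * |y k|))) μ := by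
    rw [Measure.isAddLeftInvariant_eq_smul μ volume]
    exact hI.smul_measure_nnreal
  have hS : IsClosed {y : Fin p → ℝ | ∀ z ∈ Λ, 0 ≤ ∑ k, y k * z k} := by
    simp only [Set.setOf_forall]
    refine isClosed_iInter fun z => isClosed_iInter fun _ => isClosed_le continuous_const (by fun_prop)
  refine Integrable.mono' hIμ.integrableOn
    (Continuous.aestronglyMeasurable (by fun_prop)) ?_
  refine ae_restrict_of_forall_mem hS.measurableSet fun y hy => ?_
  rw [Real.norm_of_nonneg (Real.exp_nonneg _), ← Real.exp_sum]
  apply Real.exp_le_exp.2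
  rw [Finset.sum_neg_distrib, neg_le_neg_iff]
  have key : ∀ k, ∀ s : ℝ, |s| < ε → 0 ≤ (∑ j, y j * x j) + y k * s := by
    intro k s hs
    have hm : x + Pi.single k s ∈ Λ := by
      apply hball
      rw [Metric.mem_ball, dist_eq_norm, add_sub_cancel_left, Pi.norm_single]
      exact hs
    have := hy _ hm
    simpa [mul_add, Finset.sum_add_distrib, Pi.single_apply] using this
  have hx0 : 0 ≤ ∑ j, y j * x j := hy _ (interior_subset hx)
  have hk : ∀ k, ε / 2 / (p + 1) * |y k| ≤ (∑ j, y j * x j) / (p + 1) := by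
    intro k
    rw [div_mul_eq_mul_div]
    gcongr
    have h1 := key k (ε / 2) (by rw [abs_of_pos] <;> linarith)
    have h2 := key k (-(ε / 2)) (by rw [abs_neg, abs_of_pos] <;> linarith)
    rcases abs_cases (y k) with ⟨h, _⟩ | ⟨h, _⟩ <;> rw [h] <;> linarith
  calc _ ≤ ∑ _k : Fin p, (∑ j, y j * x j) / ((p : ℝ) + 1) := Finset.sum_le_sum fun k _ => hk k
    _ = p * ((∑ j, y j * x j) / ((p : ℝ) + 1)) := by simp
    _ ≤ ∑ j, y j * x j := by
      rw [mul_div_assoc', div_le_iff₀ (by positivity)]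
      nlinarith
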